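/- For k ≥ 1, the characteristic polynomial of PN_k, the restriction of the composite P∘N to the degree-k homogeneous component of Kreimer's Hopf algebra H_K, is Ch(PN_k, λ) = (λ − C(k+1,2)) · Π_{r=0}^{k−1} (λ − Σ_{j=0}^{r}(k−j))^{T_{k−r} − T_{k−r−1}}, where T_i denotes the number of isomorphism classes of rooted trees with i+1 vertices (which equals the dimension of the degree-i component of H_K) and C(k+1,2) is the binomial coefficient. -/

import Mathlib

attribute [local instance] Classical.propDecidable

inductive PlanarTree : Type where
  | node : List PlanarTree → PlanarTree

namespace PlanarTree

/-- Isomorphism of (planar representatives of) rooted trees: the lists of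
principal branches match up, pairwise isomorphically, after a permutation. -/
inductive Iso : PlanarTree → PlanarTree → Prop where
  | node {l m l' : List PlanarTree} :
      List.Perm l m → List.Forall₂ Iso m l' → Iso (node l) (node l')

/-- Number of vertices. -/
def size : PlanarTree → ℕ
  | node l => 1 + (l.attach.map fun c => size c.1).sum
decreasing_by simp only [PlanarTree.node.sizeOf_spec]; exact Nat.lt_of_lt_of_le (List.sizeOf_lt_of_mem c.2) (Nat.le_add_left _ _)

mutual
  /-- All trees obtained by attaching the root of `s` by a new edge to some vertex. -/
  def graftList (s : PlanarTree) : PlanarTree → List PlanarTree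
    | node l => node (s :: l) :: (graftAux s l).map node
  def graftAux (s : PlanarTree) : List PlanarTree → List (List PlanarTree)
    | [] => []
    | a :: l => ((graftList s a).map (· :: l)) ++ (graftAux s l).map (a :: ·)
end

/-- All trees obtained by adding a new edge and terminal vertex at some vertex. -/
def growList (t : PlanarTree) : List PlanarTree := graftList (node []) t

mutual
  /-- All trees obtained by deleting one (non-root) terminal vertex. -/
  def pruneList : PlanarTree → List PlanarTree
    | node l => (pruneAux l).map node
  def pruneAux : List PlanarTree → List (List PlanarTree)
    | [] => []
    | a :: l =>
        (match a with | node [] => [l] | _ => []) ++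
        ((pruneList a).map (· :: l)) ++ (pruneAux l).map (a :: ·)
end

mutual
  /-- All pairs (cut-off subtree, remaining tree) obtained by cutting one edge. -/
  def cutPairs : PlanarTree → List (PlanarTree × PlanarTree)
    | node l => (cutAux l).map fun x => (x.1, node x.2)
  def cutAux : List PlanarTree → List (PlanarTree × List PlanarTree)
    | [] => []
    | a :: l =>
        (a, l) :: (((cutPairs a).map fun x => (x.1, x.2 :: l)) ++
          (cutAux l).map fun x => (x.1, a :: x.2))
end

/-- The order of the symmetry group `SG(t)`: the product over all vertices `v`
of the number of permutations of the branches at `v` exchanging isomorphic branches. -/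
noncomputable def sg : PlanarTree → ℕ
  | node l =>
      (l.attach.map fun c => sg c.1).prod *
        Nat.card {σ : Equiv.Perm (Fin l.length) // ∀ i, Iso (l.get (σ i)) (l.get i)}
decreasing_by simp only [PlanarTree.node.sizeOf_spec]; exact Nat.lt_of_lt_of_le (List.sizeOf_lt_of_mem c.2) (Nat.le_add_left _ _)

/-- Vertices of a planar tree, encoded as paths of child-indices from the root. -/
inductive IsVertex : PlanarTree → List ℕ → Prop where
  | root (t : PlanarTree) : IsVertex t []
  | child {l : List PlanarTree} {i : ℕ} {c : PlanarTree} {p : List ℕ} :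
      l[i]? = some c → IsVertex c p → IsVertex (node l) (i :: p)

def Vertex (t : PlanarTree) : Type := {p : List ℕ // IsVertex t p}

/-- `v` lies strictly below `w` in the tree order (i.e. `w` is a proper ancestor of `v`). -/
def StrictBelow {t : PlanarTree} (v w : Vertex t) : Prop := w.1 <+: v.1 ∧ w.1 ≠ v.1

/-- A labelling of `t`. -/
def Labelling (t : PlanarTree) : Type :=
  {f : Vertex t ≃ Fin t.size // ∀ v w, StrictBelow v w → f w < f v}

/-- Equivalence of labellings: they differ by an automorphism of the rooted tree. -/
def labelEquiv {t : PlanarTree} (f g : Labelling t) : Prop :=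
  ∃ φ : Equiv.Perm (Vertex t),
    (∀ v w, StrictBelow (φ v) (φ w) ↔ StrictBelow v w) ∧ ∀ v, f.1 (φ v) = g.1 v

end PlanarTree

/-- Rooted trees: isomorphism classes of planar rooted trees. -/
instance planarSetoid : Setoid PlanarTree := Relation.EqvGen.setoid PlanarTree.Iso

def RTree : Type := Quotient planarSetoid

namespace RTree

def mk (p : PlanarTree) : RTree := ⟦p⟧

/-- A chosen planar representative. -/
noncomputable def rep (T : RTree) : PlanarTree := Quotient.out T

noncomputable def size (T : RTree) : ℕ := T.rep.size

/-- The order of the symmetry (automorphism) group of `T`. -/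
noncomputable def sg (T : RTree) : ℕ := T.rep.sg

/-- The one-vertex tree. -/
def bullet : RTree := mk (PlanarTree.node [])

/-- `Covers T T'` means `T ⊲ T'`: `T` is obtained from `T'` by deleting one terminal vertex. -/
noncomputable def Covers (T T' : RTree) : Prop :=
  ∃ p ∈ T'.rep.pruneList, mk p = T

/-- `n(T;T')`: the number of vertices of `T` to which a new edge can be added to obtain `T'`. -/
noncomputable def nCov (T T' : RTree) : ℕ :=
  T.rep.growList.countP fun p => decide (mk p = T')

/-- `m(T;T')`: the number of (terminal) edges of `T'` which when removed leave `T`. -/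
noncomputable def mCov (T T' : RTree) : ℕ :=
  T'.rep.pruneList.countP fun p => decide (mk p = T)

/-- `n(T₁,T₂;T₃)`: the number of vertices of `T₂` such that attaching the root of `T₁`
there by a new edge yields `T₃`. -/
noncomputable def nTri (T₁ T₂ T₃ : RTree) : ℕ :=
  (PlanarTree.graftList T₁.rep T₂.rep).countP fun p => decide (mk p = T₃)

/-- `m(T₁,T₂;T₃)`: the number of edges of `T₃` whose removal cuts off a subtree
isomorphic to `T₁` leaving `T₂` (the piece containing the root). -/
noncomputable def mTri (T₁ T₂ T₃ : RTree) : ℕ :=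
  T₃.rep.cutPairs.countP fun x => decide (mk x.1 = T₁ ∧ mk x.2 = T₂)

end RTree

section Ops

variable (k : Type*) [Semiring k]

/-- The element `𝔑(T) = Σ_{T ⊲ T'} n(T;T')·T'` of `k{T}`. -/
noncomputable def growF (T : RTree) : RTree →₀ k :=
  (T.rep.growList.map fun p => Finsupp.single (RTree.mk p) (1 : k)).sum

/-- The element `𝔓(T) = Σ_{T' ⊲ T} m(T';T)·T'` of `k{T}`. -/
noncomputable def pruneF (T : RTree) : RTree →₀ k :=
  (T.rep.pruneList.map fun p => Finsupp.single (RTree.mk p) (1 : k)).sum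

/-- The growth operator `𝔑` on `k{T}`. -/
noncomputable def Grow : Module.End k (RTree →₀ k) :=
  Finsupp.linearCombination k (growF k)

/-- The pruning operator `𝔓` on `k{T}`. -/
noncomputable def Prune : Module.End k (RTree →₀ k) :=
  Finsupp.linearCombination k (pruneF k)

/-- The operator `𝔇` on `k{T}`, `𝔇(t) = |t|·t`. -/
noncomputable def Diag : Module.End k (RTree →₀ k) :=
  Finsupp.linearCombination k fun T => (T.size : k) • Finsupp.single T 1

/-- The inner product on `k{T}` determined by `(t,t') = |SG(t)|·δ_{t,t'}`. -/
noncomputable def innerT (x y : RTree →₀ k) : k :=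
  x.sum fun T c => c * y T * (T.sg : k)

/-- Generalized multiplicity `n(T;T')`: coefficient of `T'` in `𝔑^{|T'|-|T|}(T)`. -/
noncomputable def nGen (T T' : RTree) : k :=
  ((Grow k ^ (T'.size - T.size)) (Finsupp.single T 1)) T'

/-- Generalized multiplicity `m(T;T')`: coefficient of `T` in `𝔓^{|T'|-|T|}(T')`. -/
noncomputable def mGen (T T' : RTree) : k :=
  ((Prune k ^ (T'.size - T.size)) (Finsupp.single T' 1)) T

end Ops

section Kreimer

variable (k : Type*) [CommSemiring k]

/-- Kreimer's Hopf algebra `H_K`, as a commutative algebra: the free polynomial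
algebra on rooted trees. -/
abbrev HK := MvPolynomial RTree k

/-- The inclusion `k{T} → H_K` of the linear span of the variables. -/
noncomputable def toHK : (RTree →₀ k) →ₗ[k] HK k :=
  Finsupp.linearCombination k fun T => MvPolynomial.X T

/-- The growth derivation `N` on `H_K`, with `N(t) = 𝔑(t)` for rooted trees `t`. -/
noncomputable def ND : Derivation k (HK k) (HK k) :=
  MvPolynomial.mkDerivation k fun T => toHK k (growF k T)

/-- The pruning derivation `P` on `H_K`, with `P(t) = 𝔓(t)` for `|t| ≥ 2`, `P(•) = 1`. -/
noncomputable def PD : Derivation k (HK k) (HK k) :=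
  MvPolynomial.mkDerivation k fun T =>
    if T = RTree.bullet then 1 else toHK k (pruneF k T)

/-- The grading derivation `D` on `H_K`, multiplying each homogeneous element of
degree `n` by `n`; it is the derivation with `D(t) = |t|·t` for rooted trees `t`. -/
noncomputable def DD : Derivation k (HK k) (HK k) :=
  MvPolynomial.mkDerivation k fun T => (T.size : k) • MvPolynomial.X T

/-- The map `B₊ : H_K → k{T}` sending a forest to the tree obtained by attaching
all its roots to a new root vertex. -/
noncomputable def forestTree (d : RTree →₀ ℕ) : RTree :=
  RTree.mk (PlanarTree.node
    (d.support.toList.flatMap fun T => List.replicate (d T) T.rep))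

noncomputable def Bplus (p : HK k) : RTree →₀ k :=
  ∑ d ∈ p.support, Finsupp.single (forestTree d) (MvPolynomial.coeff d p)

/-- The inner product on `H_K`. -/
noncomputable def innerHK (u v : HK k) : k := innerT k (Bplus k u) (Bplus k v)

/-- The degree-`n` homogeneous component of `H_K`. -/
noncomputable abbrev HKcomp (n : ℕ) : Submodule k (HK k) :=
  MvPolynomial.weightedHomogeneousSubmodule k (fun T : RTree => T.size) n

/-- `T_i`: the number of rooted trees with `i+1` vertices. -/
noncomputable def Tcard (i : ℕ) : ℕ := Nat.card {T : RTree // T.size = i + 1}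

end Kreimer

namespace PlanarTree

@[elab_as_elim]
theorem branchInduction {C : PlanarTree → Prop}
    (h : ∀ l : List PlanarTree, (∀ a ∈ l, C a) → C (node l)) : ∀ p, C p
  | node l => h l fun a _ => branchInduction h a
decreasing_by
  simp only [PlanarTree.node.sizeOf_spec]
  exact Nat.lt_of_lt_of_le (List.sizeOf_lt_of_mem ‹_›) (Nat.le_add_left _ _)

theorem Iso.refl (p : PlanarTree) : Iso p p := by
  induction p using branchInduction with
  | h l ih => exact .node (.refl l) (List.forall₂_same.2 ih)

theorem size_node (l : List PlanarTree) : (node l).size = 1 + (l.map size).sum := by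
  rw [size, List.map_attach_eq_pmap, List.pmap_eq_map]

end PlanarTree

namespace RTree

open PlanarTree

theorem mk_rep (T : RTree) : mk T.rep = T := Quotient.out_eq T

theorem mk_eq_of_iso {p q : PlanarTree} (h : Iso p q) : mk p = mk q :=
  Quotient.sound (Relation.EqvGen.rel _ _ h)

/-- The multiset of principal branches of a planar tree, up to isomorphism. -/
def planarBranches : PlanarTree → Multiset RTree
  | node l => (l.map mk : Multiset RTree)

theorem planarBranches_eq_of_iso {p q : PlanarTree} (h : Iso p q) :
    planarBranches p = planarBranches q := by
  obtain ⟨hp, hf⟩ := h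
  refine (Multiset.coe_eq_coe.2 (hp.map mk)).trans ?_
  refine congrArg _ ?_
  rw [← List.forall₂_eq_eq_eq, List.forall₂_map_left_iff, List.forall₂_map_right_iff]
  exact hf.imp fun _ _ => mk_eq_of_iso

/-- The multiset of principal branches of a rooted tree. -/
def branches : RTree → Multiset RTree :=
  Quotient.lift planarBranches fun p q h => by
    induction h with
    | rel _ _ h => exact planarBranches_eq_of_iso h
    | refl => rfl
    | symm _ _ _ ih => exact ih.symm
    | trans _ _ _ _ _ ih₁ ih₂ => exact ih₁.trans ih₂

theorem branches_mk_node (l : List PlanarTree) :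
    branches (mk (node l)) = (l.map mk : Multiset RTree) := rfl

theorem mk_node_perm {l m : List PlanarTree} (h : l.Perm m) : mk (node l) = mk (node m) :=
  mk_eq_of_iso (.node h (List.forall₂_same.2 fun a _ => Iso.refl a))

theorem mk_node_cons_congr {a b : PlanarTree} (h : mk a = mk b) (l : List PlanarTree) :
    mk (node (a :: l)) = mk (node (b :: l)) := by
  have h' : Relation.EqvGen Iso a b := Quotient.exact h
  clear h
  induction h' with
  | rel _ _ h =>
    exact mk_eq_of_iso (.node (.refl _) (.cons h (List.forall₂_same.2 fun a _ => Iso.refl a)))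
  | refl => rfl
  | symm _ _ _ ih => exact ih.symm
  | trans _ _ _ _ _ ih₁ ih₂ => exact ih₁.trans ih₂

/-- The rooted tree whose principal branches form a given forest. -/
noncomputable def plant (s : Multiset RTree) : RTree := mk (node (s.toList.map rep))

theorem mk_node_append_rep (l u : List PlanarTree) :
    mk (node (l ++ u)) = mk (node ((l.map mk).map rep ++ u)) := by
  induction l generalizing u with
  | nil => rfl
  | cons a l ih =>
    calc mk (node (a :: (l ++ u))) = mk (node (rep (mk a) :: (l ++ u))) :=
          mk_node_cons_congr (mk_rep _).symm _
      _ = mk (node (l ++ rep (mk a) :: u)) := mk_node_perm List.perm_middle.symm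
      _ = mk (node ((l.map mk).map rep ++ rep (mk a) :: u)) := ih _
      _ = _ := mk_node_perm List.perm_middle

theorem mk_node (l : List PlanarTree) : mk (node l) = plant (l.map mk : Multiset RTree) := by
  have h := mk_node_append_rep l []
  simp only [List.append_nil] at h
  rw [h, plant]
  refine mk_node_perm (List.Perm.map _ (Multiset.coe_eq_coe.1 ?_))
  rw [Multiset.coe_toList]

theorem branches_plant (s : Multiset RTree) : branches (plant s) = s := by
  rw [plant, branches_mk_node, List.map_map, show mk ∘ rep = id from funext mk_rep, List.map_id,
    Multiset.coe_toList]

theorem plant_branches (T : RTree) : plant (branches T) = T := by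
  obtain ⟨⟨l⟩, rfl⟩ : ∃ p, mk p = T := ⟨_, mk_rep T⟩
  rw [mk_node, branches_plant]

/-- Rooted trees correspond to forests by deleting the root. -/
noncomputable def branchesEquiv : RTree ≃ Multiset RTree where
  toFun := branches
  invFun := plant
  left_inv := plant_branches
  right_inv := branches_plant

theorem bullet_eq_plant : bullet = plant 0 := mk_node []

theorem mk_node_eq_bullet {l : List PlanarTree} : mk (node l) = bullet ↔ l = [] := by
  refine ⟨fun h => ?_, fun h => h ▸ rfl⟩
  have := congrArg branches h
  rw [bullet, branches_mk_node, branches_mk_node] at this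
  simpa using this

theorem mk_node_eq_plant {l : List PlanarTree} {s : Multiset RTree} :
    mk (node l) = plant s ↔ (l.map mk : Multiset RTree) = s := by
  rw [mk_node]
  exact branchesEquiv.symm.injective.eq_iff

@[elab_as_elim]
theorem plantInduction {C : RTree → Prop}
    (h : ∀ s : Multiset RTree, (∀ T ∈ s, C T) → C (plant s)) (T : RTree) : C T := by
  obtain ⟨p, rfl⟩ : ∃ p, mk p = T := ⟨_, mk_rep T⟩
  induction p using branchInduction with
  | h l ih =>
    rw [mk_node]
    refine h _ fun T hT => ?_
    obtain ⟨a, ha, rfl⟩ := List.mem_map.1 (Multiset.mem_coe.1 hT)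
    exact ih a ha

theorem size_mk (p : PlanarTree) : (mk p).size = p.size := by
  suffices ∀ T : RTree, ∀ p, mk p = T → p.size = T.size from (this _ p rfl).symm
  intro T
  induction T using plantInduction with
  | h s ih =>
    have key : ∀ p, mk p = plant s → p.size = 1 + (s.map size).sum := by
      rintro ⟨l⟩ hp
      obtain rfl := mk_node_eq_plant.1 hp
      rw [size_node, Multiset.map_coe, Multiset.sum_coe, List.map_map]
      congr 2
      refine List.map_congr_left fun a ha => ?_
      exact ih _ (Multiset.mem_coe.2 (List.mem_map_of_mem ha)) a rfl
    intro p hp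
    rw [key p hp, size, key _ (mk_rep _)]

theorem size_plant (s : Multiset RTree) : (plant s).size = 1 + (s.map size).sum := by
  rw [plant, size_mk, size_node, List.map_map]
  conv_rhs => rw [← s.coe_toList, Multiset.map_coe, Multiset.sum_coe]
  rfl

end RTree

section Operators

open MvPolynomial PlanarTree RTree

variable (k : Type*) [CommRing k]

/-- The monomial of `H_K` attached to a forest. -/
noncomputable def forestMon (s : Multiset RTree) : HK k := (s.map X).prod

@[simp]
theorem forestMon_zero : forestMon k 0 = 1 := rfl

@[simp]
theorem forestMon_cons (T : RTree) (s : Multiset RTree) :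
    forestMon k (T ::ₘ s) = X T * forestMon k s := by
  simp [forestMon]

theorem monomial_toFinsupp (s : Multiset RTree) :
    monomial (Multiset.toFinsupp s) (1 : k) = forestMon k s := by
  induction s using Multiset.induction with
  | empty => simp
  | cons T s ih =>
    rw [forestMon_cons, ← ih, ← Multiset.singleton_add, map_add, Multiset.toFinsupp_singleton, X,
      monomial_mul, one_mul]

theorem linearMap_ext_forestMon {k} [CommRing k] {M : Type*} [AddCommGroup M] [Module k M]
    {f g : HK k →ₗ[k] M} (h : ∀ s, f (forestMon k s) = g (forestMon k s)) : f = g := by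
  refine (basisMonomials RTree k).ext fun d => ?_
  have := h (Multiset.toFinsupp.symm d)
  rwa [← monomial_toFinsupp, AddEquiv.apply_symm_apply] at this

/-- The linear map joining the trees of a forest to a new root. -/
noncomputable def joinRoot : HK k →ₗ[k] HK k :=
  (basisMonomials RTree k).constr k fun d => X (plant (Multiset.toFinsupp.symm d))

@[simp]
theorem joinRoot_forestMon (s : Multiset RTree) : joinRoot k (forestMon k s) = X (plant s) := by
  rw [← monomial_toFinsupp, joinRoot]
  have := (basisMonomials RTree k).constr_basis k
    (fun d => (X (plant (Multiset.toFinsupp.symm d)) : HK k)) (Multiset.toFinsupp s)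
  rw [coe_basisMonomials] at this
  rw [this, AddEquiv.symm_apply_apply]

/-- The monomial of `H_K` attached to a list of planar trees. -/
noncomputable def listMon (l : List PlanarTree) : HK k := forestMon k (l.map mk : Multiset RTree)

theorem listMon_nil : listMon k [] = 1 := rfl

theorem listMon_cons (a : PlanarTree) (l : List PlanarTree) :
    listMon k (a :: l) = X (mk a) * listMon k l := by
  simp [listMon, forestMon]

theorem joinRoot_listMon (l : List PlanarTree) : joinRoot k (listMon k l) = X (mk (node l)) := by
  rw [listMon, joinRoot_forestMon, mk_node]

theorem toHK_sum_single (l : List PlanarTree) :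
    toHK k (l.map fun p => Finsupp.single (mk p) (1 : k)).sum = (l.map fun p => X (mk p)).sum := by
  rw [map_list_sum, List.map_map]
  congr 1
  refine List.map_congr_left fun p _ => ?_
  simp [toHK]

theorem sum_map_node (L : List (List PlanarTree)) :
    ((L.map node).map fun p => (X (mk p) : HK k)).sum
      = joinRoot k (L.map (listMon k)).sum := by
  rw [map_list_sum, List.map_map, List.map_map]
  congr 1
  exact List.map_congr_left fun l _ => (joinRoot_listMon k l).symm

theorem sum_listMon_map_cons (a : PlanarTree) (L : List (List PlanarTree)) :
    ((L.map (a :: ·)).map (listMon k)).sum = X (mk a) * (L.map (listMon k)).sum := by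
  rw [← List.sum_map_mul_left, List.map_map]
  exact congrArg _ (List.map_congr_left fun l _ => listMon_cons k a l)

theorem sum_listMon_map_cons_left (L : List PlanarTree) (l : List PlanarTree) :
    ((L.map (· :: l)).map (listMon k)).sum
      = (L.map fun p => (X (mk p) : HK k)).sum * listMon k l := by
  rw [← List.sum_map_mul_right, List.map_map]
  exact congrArg _ (List.map_congr_left fun a _ => listMon_cons k a l)

theorem ND_X (T : RTree) : ND k (X T) = (T.rep.growList.map fun p => (X (mk p) : HK k)).sum := by
  rw [ND, mkDerivation_X, growF, toHK_sum_single]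

theorem PD_X (T : RTree) :
    PD k (X T) =
      if T = bullet then 1 else (T.rep.pruneList.map fun p => (X (mk p) : HK k)).sum := by
  rw [PD, mkDerivation_X, pruneF, toHK_sum_single]

theorem DD_X (T : RTree) : DD k (X T) = (T.size : k) • X T := by
  rw [DD, mkDerivation_X]

theorem sum_graftAux {l : List PlanarTree}
    (h : ∀ a ∈ l, (a.growList.map fun p => (X (mk p) : HK k)).sum = ND k (X (mk a))) :
    ((graftAux (node []) l).map (listMon k)).sum = ND k (listMon k l) := by
  induction l with
  | nil => simp [graftAux, listMon_nil]
  | cons a l ih =>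
    rw [List.forall_mem_cons] at h
    rw [graftAux, List.map_append, List.sum_append, sum_listMon_map_cons_left,
      sum_listMon_map_cons, ih h.2, listMon_cons, Derivation.leibniz, ← h.1, growList]
    simp only [smul_eq_mul]
    ring

theorem exists_coe_map_mk (s : Multiset RTree) :
    ∃ l : List PlanarTree, (l.map mk : Multiset RTree) = s :=
  ⟨s.toList.map rep, by
    rw [List.map_map, show mk ∘ rep = id from funext mk_rep, List.map_id, Multiset.coe_toList]⟩

theorem sum_growList_node {l : List PlanarTree}
    (h : ∀ a ∈ l, (a.growList.map fun p => (X (mk p) : HK k)).sum = ND k (X (mk a))) :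
    ((node l).growList.map fun p => (X (mk p) : HK k)).sum
      = joinRoot k (X bullet * listMon k l + ND k (listMon k l)) := by
  rw [growList, graftList, List.map_cons, List.sum_cons, sum_map_node, sum_graftAux k h, map_add,
    ← joinRoot_listMon, listMon_cons]
  rfl

theorem sum_growList (p : PlanarTree) :
    (p.growList.map fun p => (X (mk p) : HK k)).sum = ND k (X (mk p)) := by
  suffices ∀ T : RTree, ∀ p, mk p = T →
    (p.growList.map fun p => (X (mk p) : HK k)).sum = ND k (X T) from this _ p rfl
  intro T
  induction T using plantInduction with
  | h s ih =>
    have key : ∀ p, mk p = plant s → (p.growList.map fun p => (X (mk p) : HK k)).sum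
        = joinRoot k (X bullet * forestMon k s + ND k (forestMon k s)) := by
      rintro ⟨l⟩ hp
      obtain rfl := mk_node_eq_plant.1 hp
      exact sum_growList_node k
        fun a ha => ih _ (Multiset.mem_coe.2 (List.mem_map_of_mem ha)) a rfl
    intro p hp
    rw [key p hp, ND_X, key _ (mk_rep _)]

theorem ND_joinRoot (x : HK k) :
    ND k (joinRoot k x) = joinRoot k (X bullet * x + ND k x) := by
  suffices h : (ND k : HK k →ₗ[k] HK k) ∘ₗ joinRoot k
      = joinRoot k ∘ₗ (LinearMap.mulLeft k (X bullet) + (ND k : HK k →ₗ[k] HK k)) from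
    LinearMap.congr_fun h x
  refine linearMap_ext_forestMon fun s => ?_
  obtain ⟨l, rfl⟩ := exists_coe_map_mk s
  simp only [LinearMap.comp_apply, LinearMap.add_apply, LinearMap.mulLeft_apply,
    Derivation.coeFn_coe]
  rw [← listMon, joinRoot_listMon, ← sum_growList, sum_growList_node k fun a _ => sum_growList k a]

theorem sum_pruneAux {l : List PlanarTree}
    (h : ∀ a ∈ l, (if a = node [] then 1 else (a.pruneList.map fun p => (X (mk p) : HK k)).sum)
      = PD k (X (mk a))) :
    ((pruneAux l).map (listMon k)).sum = PD k (listMon k l) := by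
  induction l with
  | nil => simp [pruneAux, listMon_nil]
  | cons a l ih =>
    rw [List.forall_mem_cons] at h
    rw [listMon_cons, Derivation.leibniz, ← h.1, ← ih h.2]
    obtain ⟨_ | ⟨b, m⟩⟩ := a
    · rw [pruneAux, List.map_append, List.sum_append, sum_listMon_map_cons]
      simp [pruneList, pruneAux, add_comm]
    · rw [pruneAux, List.nil_append, List.map_append, List.sum_append,
        sum_listMon_map_cons_left, sum_listMon_map_cons, if_neg (by simp)]
      · simp only [smul_eq_mul]
        ring
      · simp

theorem sum_pruneList_node {l : List PlanarTree}
    (h : ∀ a ∈ l, (if a = node [] then 1 else (a.pruneList.map fun p => (X (mk p) : HK k)).sum)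
      = PD k (X (mk a))) :
    (if node l = node [] then 1 else ((node l).pruneList.map fun p => (X (mk p) : HK k)).sum)
      = joinRoot k (PD k (listMon k l)) + C (constantCoeff (listMon k l)) := by
  rw [pruneList, sum_map_node, sum_pruneAux k h]
  cases l with
  | nil => simp [listMon_nil]
  | cons a l => simp [listMon_cons]

theorem sum_pruneList (p : PlanarTree) :
    (if p = node [] then 1 else (p.pruneList.map fun p => (X (mk p) : HK k)).sum)
      = PD k (X (mk p)) := by
  suffices ∀ T : RTree, ∀ p, mk p = T →
    (if p = node [] then 1 else (p.pruneList.map fun p => (X (mk p) : HK k)).sum)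
      = PD k (X T) from this _ p rfl
  intro T
  induction T using plantInduction with
  | h s ih =>
    have key : ∀ p, mk p = plant s →
        (if p = node [] then 1 else (p.pruneList.map fun p => (X (mk p) : HK k)).sum)
          = joinRoot k (PD k (forestMon k s)) + C (constantCoeff (forestMon k s)) := by
      rintro ⟨l⟩ hp
      obtain rfl := mk_node_eq_plant.1 hp
      exact sum_pruneList_node k
        fun a ha => ih _ (Multiset.mem_coe.2 (List.mem_map_of_mem ha)) a rfl
    have eq_nil_iff : ∀ p, p = node [] ↔ mk p = bullet := by
      rintro ⟨l⟩
      rw [mk_node_eq_bullet, node.injEq]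
    intro p hp
    rw [key p hp, ← key _ (mk_rep _), PD_X]
    simp only [eq_nil_iff, mk_rep]

theorem PD_joinRoot (x : HK k) :
    PD k (joinRoot k x) = joinRoot k (PD k x) + C (constantCoeff x) := by
  suffices h : (PD k : HK k →ₗ[k] HK k) ∘ₗ joinRoot k
      = joinRoot k ∘ₗ (PD k : HK k →ₗ[k] HK k)
        + Algebra.linearMap k (HK k) ∘ₗ lcoeff k (0 : RTree →₀ ℕ) from
    LinearMap.congr_fun h x
  refine linearMap_ext_forestMon fun s => ?_
  obtain ⟨l, rfl⟩ := exists_coe_map_mk s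
  change PD k (joinRoot k (listMon k l))
    = joinRoot k (PD k (listMon k l)) + C (constantCoeff (listMon k l))
  rw [joinRoot_listMon, ← sum_pruneList, sum_pruneList_node k fun a _ => sum_pruneList k a]

theorem DD_forestMon (s : Multiset RTree) :
    DD k (forestMon k s) = (((s.map RTree.size).sum : ℕ) : k) • forestMon k s := by
  induction s using Multiset.induction with
  | empty => simp
  | cons T s ih =>
    rw [forestMon_cons, Derivation.leibniz, ih, DD_X]
    simp only [smul_eq_mul, smul_eq_C_mul, Multiset.map_cons, Multiset.sum_cons, Nat.cast_add,
      map_add]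
    ring

theorem DD_joinRoot (x : HK k) : DD k (joinRoot k x) = joinRoot k (x + DD k x) := by
  suffices h : (DD k : HK k →ₗ[k] HK k) ∘ₗ joinRoot k
      = joinRoot k ∘ₗ (LinearMap.id + (DD k : HK k →ₗ[k] HK k)) from
    LinearMap.congr_fun h x
  refine linearMap_ext_forestMon fun s => ?_
  change DD k (joinRoot k (forestMon k s))
    = joinRoot k (forestMon k s + DD k (forestMon k s))
  rw [joinRoot_forestMon, DD_X, DD_forestMon, map_add, map_smul, joinRoot_forestMon, size_plant]
  rw [Nat.cast_add, Nat.cast_one, add_smul, one_smul]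

theorem size_bullet : bullet.size = 1 := by
  rw [bullet_eq_plant, size_plant]
  rfl

theorem derivation_forestMon_congr {D₁ D₂ : Derivation k (HK k) (HK k)} {s : Multiset RTree}
    (h : ∀ T ∈ s, D₁ (X T) = D₂ (X T)) : D₁ (forestMon k s) = D₂ (forestMon k s) := by
  induction s using Multiset.induction with
  | empty => simp
  | cons T s ih =>
    rw [Multiset.forall_mem_cons] at h
    rw [forestMon_cons, Derivation.leibniz, Derivation.leibniz, h.1, ih h.2]

/-- To identify derivations of `H_K`, it suffices to compare them on a tree assuming that they
agree on the forest of its branches. -/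
theorem derivation_ext_joinRoot {D₁ D₂ : Derivation k (HK k) (HK k)}
    (h : ∀ x, D₁ x = D₂ x → D₁ (joinRoot k x) = D₂ (joinRoot k x)) : D₁ = D₂ := by
  refine derivation_ext fun T => ?_
  induction T using plantInduction with
  | h s ih =>
    rw [← joinRoot_forestMon]
    exact h _ (derivation_forestMon_congr k ih)

theorem PD_X_bullet : PD k (X bullet) = 1 := by
  rw [PD_X, if_pos rfl]

theorem DD_X_bullet : DD k (X bullet) = X bullet := by
  rw [DD_X, size_bullet, Nat.cast_one, one_smul]

theorem constantCoeff_joinRoot (x : HK k) : constantCoeff (joinRoot k x) = 0 := by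
  suffices h : lcoeff k (0 : RTree →₀ ℕ) ∘ₗ joinRoot k = 0 from LinearMap.congr_fun h x
  refine linearMap_ext_forestMon fun s => ?_
  rw [LinearMap.comp_apply, joinRoot_forestMon]
  exact constantCoeff_X k _

theorem constantCoeff_ND (x : HK k) : constantCoeff (ND k x) = 0 := by
  suffices h : lcoeff k (0 : RTree →₀ ℕ) ∘ₗ (ND k : HK k →ₗ[k] HK k) = 0 from
    LinearMap.congr_fun h x
  refine linearMap_ext_forestMon fun s => ?_
  change constantCoeff (ND k (forestMon k s)) = 0
  induction s using Multiset.induction with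
  | empty => simp
  | cons T s ih =>
    rw [forestMon_cons, Derivation.leibniz, ← plant_branches T, ← joinRoot_forestMon, ND_joinRoot]
    simp [ih, constantCoeff_joinRoot]

theorem constantCoeff_DD (x : HK k) : constantCoeff (DD k x) = 0 := by
  suffices h : lcoeff k (0 : RTree →₀ ℕ) ∘ₗ (DD k : HK k →ₗ[k] HK k) = 0 from
    LinearMap.congr_fun h x
  refine linearMap_ext_forestMon fun s => ?_
  change constantCoeff (DD k (forestMon k s)) = 0
  induction s using Multiset.induction with
  | empty => simp
  | cons T s ih =>
    rw [forestMon_cons, Derivation.leibniz, DD_X]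
    simp [ih]

theorem lie_PD_ND : ⁅PD k, ND k⁆ = DD k := by
  refine derivation_ext_joinRoot k fun x hx => ?_
  rw [Derivation.commutator_apply, sub_eq_iff_eq_add] at hx ⊢
  rw [ND_joinRoot, PD_joinRoot, PD_joinRoot, DD_joinRoot, map_add, map_add (ND k), ND_joinRoot,
    derivation_C, map_add constantCoeff, constantCoeff_ND, map_mul constantCoeff, constantCoeff_X,
    Derivation.leibniz, PD_X_bullet, hx]
  simp only [smul_eq_mul, map_add, mul_one, zero_mul, add_zero, map_zero]
  ring

theorem lie_DD_ND : ⁅DD k, ND k⁆ = ND k := by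
  refine derivation_ext_joinRoot k fun x hx => ?_
  rw [Derivation.commutator_apply, sub_eq_iff_eq_add] at hx ⊢
  rw [ND_joinRoot, DD_joinRoot, DD_joinRoot, ND_joinRoot, map_add (DD k), map_add (ND k), hx,
    Derivation.leibniz, DD_X_bullet]
  simp only [smul_eq_mul, map_add, mul_add, mul_comm x]
  ring

theorem lie_DD_PD : ⁅DD k, PD k⁆ = -PD k := by
  refine derivation_ext_joinRoot k fun x hx => ?_
  rw [Derivation.commutator_apply, sub_eq_iff_eq_add, Derivation.neg_apply] at hx ⊢
  rw [DD_joinRoot, PD_joinRoot, PD_joinRoot, map_add (DD k), DD_joinRoot, derivation_C, hx,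
    map_add (PD k), map_add constantCoeff, constantCoeff_DD]
  simp only [map_add, map_neg, map_zero]
  ring

end Operators

section Grading

open MvPolynomial RTree

theorem weight_toFinsupp (s : Multiset RTree) :
    Finsupp.weight (fun T : RTree => T.size) (Multiset.toFinsupp s) = (s.map RTree.size).sum := by
  induction s using Multiset.induction with
  | empty => simp
  | cons T s ih =>
    rw [← Multiset.singleton_add, map_add, map_add, ih, Multiset.toFinsupp_singleton,
      Finsupp.weight_single, one_smul, Multiset.map_add, Multiset.sum_add, Multiset.map_singleton,
      Multiset.sum_singleton]

theorem size_pos (T : RTree) : 0 < T.size := by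
  rw [← plant_branches T, size_plant]
  omega

theorem Tcard_zero : Tcard 0 = 1 := by
  rw [Tcard, Nat.card_eq_one_iff_unique]
  refine ⟨⟨fun ⟨T, hT⟩ ⟨T', hT'⟩ => Subtype.ext ?_⟩, ⟨⟨bullet, size_bullet⟩⟩⟩
  have key : ∀ T : RTree, T.size = 0 + 1 → T = bullet := by
    intro T hT
    rw [← plant_branches T, size_plant] at hT
    rw [← plant_branches T, bullet_eq_plant]
    congr 1
    refine Multiset.eq_zero_of_forall_notMem fun S hS => ?_
    have := Multiset.le_sum_of_mem (Multiset.mem_map_of_mem RTree.size hS)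
    have := size_pos S
    omega
  exact (key T hT).trans (key T' hT').symm

theorem coeff_DD (k : Type*) [CommRing k] (d : RTree →₀ ℕ) (x : HK k) :
    coeff d (DD k x) = (Finsupp.weight (fun T : RTree => T.size) d : k) * coeff d x := by
  suffices h : lcoeff k d ∘ₗ (DD k : HK k →ₗ[k] HK k)
      = LinearMap.mulLeft k (Finsupp.weight (fun T : RTree => T.size) d : k) ∘ₗ lcoeff k d from
    LinearMap.congr_fun h x
  refine linearMap_ext_forestMon fun s => ?_
  change coeff d (DD k (forestMon k s)) = _ * coeff d (forestMon k s)
  rw [DD_forestMon, ← weight_toFinsupp, ← monomial_toFinsupp, coeff_smul, coeff_monomial]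
  split_ifs with h
  · rw [h, smul_eq_mul]
  · simp

variable (k : Type*) [Field k]

theorem finrank_HKcomp (n : ℕ) : Module.finrank k (HKcomp k n) = Tcard n := by
  have h : HKcomp k n
      = restrictSupport k {d | Finsupp.weight (fun T : RTree => T.size) d = n} :=
    weightedHomogeneousSubmodule_eq_finsupp_supported k _ n
  rw [h, Module.finrank_eq_nat_card_basis (basisRestrictSupport k _), Tcard]
  refine Nat.card_congr
    ((Multiset.toFinsupp.symm.toEquiv.trans branchesEquiv.symm).subtypeEquiv fun d => ?_)
  obtain ⟨s, rfl⟩ := Multiset.toFinsupp.surjective d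
  change Finsupp.weight _ (Multiset.toFinsupp s) = n
    ↔ (plant (Multiset.toFinsupp.symm (Multiset.toFinsupp s))).size = n + 1
  rw [AddEquiv.symm_apply_apply, size_plant, weight_toFinsupp]
  omega

theorem ND_eq_zero_of_mem_HKcomp_zero {x : HK k} (hx : x ∈ HKcomp k 0) : ND k x = 0 := by
  have : Finsupp.NonTorsionWeight ℕ fun T : RTree => T.size :=
    Finsupp.nonTorsionWeight_of (R := ℕ) (hw := fun T => (size_pos T).ne')
  have h : x = C (coeff 0 x) := by
    ext d
    rw [coeff_C]
    split_ifs with hd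
    · rw [hd]
    · by_contra h
      exact hd ((Finsupp.weight_eq_zero_iff_eq_zero _).1 (hx h)).symm
  rw [h, derivation_C]

variable [CharZero k]

theorem mem_HKcomp_iff {n : ℕ} {x : HK k} : x ∈ HKcomp k n ↔ DD k x = (n : k) • x := by
  rw [mem_weightedHomogeneousSubmodule, MvPolynomial.ext_iff]
  refine forall_congr' fun d => ?_
  rw [coeff_DD, coeff_smul, smul_eq_mul, mul_eq_mul_right_iff, Nat.cast_inj]
  tauto

theorem ND_mem_HKcomp {n : ℕ} {x : HK k} (hx : x ∈ HKcomp k n) : ND k x ∈ HKcomp k (n + 1) := by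
  rw [mem_HKcomp_iff] at hx ⊢
  have h := DFunLike.congr_fun (lie_DD_ND k) x
  rw [Derivation.commutator_apply, hx, Derivation.map_smul, sub_eq_iff_eq_add] at h
  rw [h, Nat.cast_succ, add_smul, one_smul, add_comm]

theorem PD_mem_HKcomp {n : ℕ} {x : HK k} (hx : x ∈ HKcomp k (n + 1)) :
    PD k x ∈ HKcomp k n := by
  rw [mem_HKcomp_iff] at hx ⊢
  have h := DFunLike.congr_fun (lie_DD_PD k) x
  rw [Derivation.commutator_apply, hx, Derivation.map_smul, sub_eq_iff_eq_add, Derivation.neg_apply,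
    Nat.cast_succ, add_smul, one_smul] at h
  rw [h, add_comm, add_neg_cancel_right]

/-- Growth between consecutive homogeneous components. -/
noncomputable def growComp (n : ℕ) : HKcomp k n →ₗ[k] HKcomp k (n + 1) :=
  (ND k : HK k →ₗ[k] HK k).restrict fun _ => ND_mem_HKcomp k

/-- Pruning between consecutive homogeneous components. -/
noncomputable def pruneComp (n : ℕ) : HKcomp k (n + 1) →ₗ[k] HKcomp k n :=
  (PD k : HK k →ₗ[k] HK k).restrict fun _ => PD_mem_HKcomp k

/-- Adjoining the one-vertex tree to a forest, on a homogeneous component. -/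
noncomputable def mulBulletComp (n : ℕ) : HKcomp k n →ₗ[k] HKcomp k (n + 1) :=
  (LinearMap.mulLeft k (X bullet)).restrict fun x hx => by
    rw [mem_HKcomp_iff] at hx ⊢
    rw [LinearMap.mulLeft_apply, Derivation.leibniz, DD_X_bullet, hx, smul_eq_mul, smul_eq_mul,
      mul_smul_comm, Nat.cast_succ, add_smul, one_smul, mul_comm x]

theorem mulBulletComp_injective (n : ℕ) : Function.Injective (mulBulletComp k n) :=
  fun _ _ h => Subtype.ext (mul_left_cancel₀ (X_ne_zero bullet) (congrArg Subtype.val h))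

end Grading

theorem LinearMap.charpoly_comp_comm_of_le {K V W : Type*} [Field K] [AddCommGroup V] [Module K V]
    [AddCommGroup W] [Module K W] [Module.Finite K V] [Module.Finite K W]
    (f : V →ₗ[K] W) (g : W →ₗ[K] V) (h : Module.finrank K V ≤ Module.finrank K W) :
    (f ∘ₗ g).charpoly
      = Polynomial.X ^ (Module.finrank K W - Module.finrank K V) * (g ∘ₗ f).charpoly := by
  have b := Module.finBasis K V
  have c := Module.finBasis K W
  rw [← LinearMap.charpoly_toMatrix (f ∘ₗ g) c, ← LinearMap.charpoly_toMatrix (g ∘ₗ f) b,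
    LinearMap.toMatrix_comp c b c, LinearMap.toMatrix_comp b c b,
    Matrix.charpoly_mul_comm_of_le _ _ (by simpa using h)]
  simp

theorem LinearMap.charpoly_add_smul {K V : Type*} [Field K] [AddCommGroup V] [Module K V]
    [Module.Finite K V] (f : Module.End K V) (c : K) :
    (f + c • 1).charpoly = f.charpoly.comp (Polynomial.X - Polynomial.C c) := by
  have h := LinearMap.charpoly_sub_smul f (-c)
  rwa [neg_smul, sub_neg_eq_add, map_neg, ← sub_eq_add_neg] at h

theorem sum_range_succ_sub (n r : ℕ) :
    ∑ j ∈ Finset.range (r + 1), (n + 1 - j) = (∑ j ∈ Finset.range r, (n - j)) + (n + 1) := by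
  rw [Finset.sum_range_succ']
  simp

theorem charpoly_pruneComp_growComp (k : Type*) [Field k] [CharZero k] (n : ℕ)
    [hfin : Module.Finite k (HKcomp k n)] :
    (pruneComp k n ∘ₗ growComp k n).charpoly
      = (Polynomial.X - Polynomial.C (((n + 1).choose 2 : ℕ) : k)) *
        ∏ r ∈ Finset.range n,
          (Polynomial.X - Polynomial.C (((∑ j ∈ Finset.range (r + 1), (n - j)) : ℕ) : k))
            ^ (Tcard (n - r) - Tcard (n - r - 1)) := by
  induction n generalizing hfin with
  | zero =>
    have h : pruneComp k 0 ∘ₗ growComp k 0 = 0 := by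
      refine LinearMap.ext fun x => Subtype.ext ?_
      change PD k (ND k x) = 0
      rw [ND_eq_zero_of_mem_HKcomp_zero k x.2, map_zero]
    rw [h, LinearMap.charpoly_zero, finrank_HKcomp, Tcard_zero]
    simp
  | succ n ih =>
    have : Module.Finite k (HKcomp k n) :=
      .of_injective _ (mulBulletComp_injective k n)
    have hle := LinearMap.finrank_le_finrank_of_injective (mulBulletComp_injective k n)
    have hcomm : pruneComp k (n + 1) ∘ₗ growComp k (n + 1)
        = growComp k n ∘ₗ pruneComp k n + ((n + 1 : ℕ) : k) • (1 : Module.End k _) := by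
      refine LinearMap.ext fun x => Subtype.ext ?_
      have h := DFunLike.congr_fun (lie_PD_ND k) (x : HK k)
      rw [Derivation.commutator_apply, sub_eq_iff_eq_add', (mem_HKcomp_iff k).1 x.2] at h
      exact h
    rw [hcomm, LinearMap.charpoly_add_smul, LinearMap.charpoly_comp_comm_of_le _ _ hle, ih,
      finrank_HKcomp, finrank_HKcomp, Finset.prod_range_succ']
    simp only [Polynomial.mul_comp, Polynomial.prod_comp, Polynomial.pow_comp,
      Polynomial.sub_comp, Polynomial.X_comp, Polynomial.C_comp, sub_sub, ← map_add,
      ← Nat.cast_add, sum_range_succ_sub, Nat.add_sub_add_right]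
    rw [Nat.choose_succ_succ (n + 1) 1, Nat.choose_one_right]
    simp only [Finset.sum_range_zero, zero_add, Nat.sub_zero, Nat.add_sub_cancel, add_comm,
      mul_left_comm, mul_comm]

/-- The characteristic polynomial of the restriction `PN_n` of `P∘N`
to the degree-`n` component of `H_K`. -/
theorem stmt16 (k : Type*) [Field k] [CharZero k] (n : ℕ) (hn : 1 ≤ n)
    [Module.Finite k (HKcomp k n)]
    (g : HKcomp k n →ₗ[k] HKcomp k n)
    (hg : ∀ x : HKcomp k n, (g x : HK k) = PD k (ND k (x : HK k))) :
    g.charpoly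
      = (Polynomial.X - Polynomial.C (((n + 1).choose 2 : ℕ) : k)) *
        ∏ r ∈ Finset.range n,
          (Polynomial.X - Polynomial.C (((∑ j ∈ Finset.range (r + 1), (n - j)) : ℕ) : k))
            ^ (Tcard (n - r) - Tcard (n - r - 1)) := by
  have h : g = pruneComp k n ∘ₗ growComp k n :=
    LinearMap.ext fun x => Subtype.ext (hg x)
  rw [h, charpoly_pruneComp_growComp]
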